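/- The class of finite distributive lattices does not have the dual Ramsey property: there exist an integer k ≥ 2 and finite distributive lattices A and B admitting a surjective {0,1}-lattice homomorphism from B onto A, such that for every finite distributive lattice C there is a k-coloring χ of the set Surj(C, A) of all surjective {0,1}-lattice homomorphisms C → A satisfying χ(α ∘ f) = χ(f) for every {0,1}-lattice automorphism α of A and every f ∈ Surj(C, A), and such that for no surjective {0,1}-lattice homomorphism w : C → B is the set {f ∘ w : f ∈ Surj(B, A)} monochromatic under χ. -/

import Mathlib

open Function

/-- An element of a lattice with least element `⊥` is join-irreducible if it is not `⊥`
and `j = a ⊔ b` implies `j = a` or `j = b`. -/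
def JoinIrred {L : Type*} [Lattice L] [OrderBot L] (j : L) : Prop :=
  j ≠ ⊥ ∧ ∀ a b : L, j = a ⊔ b → j = a ∨ j = b

/-- `latN f` is the set `N(f) = {x | ∃ y, y < x ∧ f y = f x}`. -/
def latN {L K : Type*} [Preorder L] (f : L → K) : Set L :=
  {x | ∃ y, y < x ∧ f y = f x}

open Classical in
/-- `minus x S` is `x − S`: the join of the set of join-irreducibles `j` with
`j ≤ x` and `j ∉ S` (the empty join being `⊥`). -/
noncomputable def minus {L : Type*} [Lattice L] [OrderBot L] [Fintype L]
    (x : L) (S : Set L) : L :=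
  (Finset.univ.filter fun j : L => JoinIrred j ∧ j ≤ x ∧ j ∉ S).sup id

/-- A `{0,1}`-lattice homomorphism: a map preserving `⊔`, `⊓`, `⊥` and `⊤`. -/
def IsBddLatticeHom {L K : Type*} [Lattice L] [BoundedOrder L] [Lattice K] [BoundedOrder K]
    (f : L → K) : Prop :=
  (∀ x y : L, f (x ⊔ y) = f x ⊔ f y) ∧ (∀ x y : L, f (x ⊓ y) = f x ⊓ f y) ∧
    f ⊥ = ⊥ ∧ f ⊤ = ⊤

/-- `r` is a natural linear order on the bounded lattice `L`: it is a (reflexive) linear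
order whose restriction to the join-irreducibles extends the lattice order, and which is
the antilexicographic order determined by this restriction: for distinct `x`, `y`,
`x` is strictly below `y` iff the `r`-greatest join-irreducible `j` for which exactly one
of `j ≤ x`, `j ≤ y` holds satisfies `j ≤ y`. -/
def IsNaturalOrder {L : Type*} [Lattice L] [BoundedOrder L] (r : L → L → Prop) : Prop :=
  IsLinearOrder L r ∧
  (∀ j j' : L, JoinIrred j → JoinIrred j' → j ≤ j' → r j j') ∧
  ∀ x y : L, x ≠ y →
    (r x y ↔ ∃ j : L, JoinIrred j ∧ j ≤ y ∧ ¬ j ≤ x ∧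
      ∀ j' : L, JoinIrred j' → ¬ ((j' ≤ x) ↔ (j' ≤ y)) → r j' j)

/-- A homomorphism `f : L → K` between lattices carrying linear orders `rL`, `rK`
is positive if `x − N(f) ⊑ y − N(f)` implies `f x ≼ f y`. -/
def IsPositive {L K : Type*} [Lattice L] [OrderBot L] [Fintype L]
    (rL : L → L → Prop) (rK : K → K → Prop) (f : L → K) : Prop :=
  ∀ x y : L, rL (minus x (latN f)) (minus y (latN f)) → rK (f x) (f y)

open Classical in
/-- The Birkhoff dual of a `{0,1}`-lattice homomorphism: `J(f)(y) = ⋀ {x | f x ≥ y}`. -/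
noncomputable def birkhoffDual {L K : Type*} [Lattice L] [OrderTop L] [Fintype L] [Preorder K]
    (f : L → K) (y : K) : L :=
  (Finset.univ.filter fun x : L => y ≤ f x).inf id

/-- A finite distributive lattice (bundled, with `0` and `1`). -/
structure FinDistLat where
  carrier : Type
  [dist : DistribLattice carrier]
  [fin : Fintype carrier]
  [bdd : BoundedOrder carrier]

attribute [instance] FinDistLat.dist FinDistLat.fin FinDistLat.bdd

section BirkhoffDual

variable {L K M : Type*} [Lattice L] [BoundedOrder L]
  [Lattice K] [BoundedOrder K] [Lattice M] [BoundedOrder M]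

theorem IsBddLatticeHom.comp {f : K → M} {w : L → K} (hf : IsBddLatticeHom f)
    (hw : IsBddLatticeHom w) : IsBddLatticeHom (f ∘ w) := by
  obtain ⟨h₁, h₂, h₃, h₄⟩ := hf
  obtain ⟨k₁, k₂, k₃, k₄⟩ := hw
  exact ⟨by simp [h₁, k₁], by simp [h₂, k₂], by simp [h₃, k₃], by simp [h₄, k₄]⟩

variable [Fintype L]

/-- The Birkhoff dual of a homomorphism is its lower adjoint. -/
theorem birkhoffDual_le_iff {f : L → K} (hf : IsBddLatticeHom f) {y : K} {x : L} :
    birkhoffDual f y ≤ x ↔ y ≤ f x := by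
  classical
  have mono : Monotone f := fun a b hab => by
    rw [← sup_eq_right, ← hf.1, sup_eq_right.2 hab]
  refine ⟨fun h => le_trans ?_ (mono h), fun h => Finset.inf_le (f := id) (by simpa using h)⟩
  unfold birkhoffDual
  refine Finset.inf_induction (p := fun x => y ≤ f x) ?_ ?_ ?_
  · simp [hf.2.2.2]
  · intro a ha b hb
    simpa [hf.2.1] using And.intro ha hb
  · simp

theorem birkhoffDual_injective {f : L → K} (hf : IsBddLatticeHom f)
    (hs : Function.Surjective f) : Function.Injective (birkhoffDual f) := by
  intro y z h
  refine eq_of_forall_ge_iff fun t => ?_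
  obtain ⟨x, rfl⟩ := hs t
  rw [← birkhoffDual_le_iff hf, ← birkhoffDual_le_iff hf, h]

/-- If `y'` is the value at `y` of the lower adjoint of `f`, then the Birkhoff dual of `f ∘ w`
at `y` is the Birkhoff dual of `w` at `y'`. -/
theorem birkhoffDual_comp_eq {f : K → M} {w : L → K} (hf : IsBddLatticeHom f)
    (hw : IsBddLatticeHom w) {y : M} {y' : K} (h : ∀ x, y ≤ f x ↔ y' ≤ x) :
    birkhoffDual (f ∘ w) y = birkhoffDual w y' := by
  refine eq_of_forall_ge_iff fun x => ?_
  rw [birkhoffDual_le_iff (hf.comp hw), birkhoffDual_le_iff hw, Function.comp_apply, h]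

end BirkhoffDual

/-- The product of a three-element and a two-element chain has no nontrivial automorphism. -/
theorem eq_id_of_bijective_fin_three_prod_fin_two {α : Fin 3 × Fin 2 → Fin 3 × Fin 2}
    (hα : IsBddLatticeHom α) (hb : Function.Bijective α) : α = id := by
  obtain ⟨hsup, hinf, hbot, htop⟩ := hα
  have key : ∀ x y z : Fin 3 × Fin 2, x ≠ ⊥ → x ≠ y → x ⊔ y = y → y ⊓ z = ⊥ → y ⊔ z = ⊤ →
      z ≠ ⊥ → x = (1, 0) ∧ y = (2, 0) ∧ z = (0, 1) := by decide
  obtain ⟨h₁, h₂, h₃⟩ := key (α (1, 0)) (α (2, 0)) (α (0, 1))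
    (by rw [← hbot]; exact hb.1.ne (by decide)) (hb.1.ne (by decide))
    (by rw [← hsup]; exact congrArg α (by decide))
    (by rw [← hinf, ← hbot]; exact congrArg α (by decide))
    (by rw [← hsup, ← htop]; exact congrArg α (by decide))
    (by rw [← hbot]; exact hb.1.ne (by decide))
  have h₄ : α (1, 1) = (1, 1) := by
    rw [show ((1, 1) : Fin 3 × Fin 2) = (1, 0) ⊔ (0, 1) by decide, hsup, h₁, h₃]
  have hgen : ∀ x : Fin 3 × Fin 2, x = ⊥ ∨ x = (1, 0) ∨ x = (2, 0) ∨ x = (0, 1) ∨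
      x = (1, 1) ∨ x = ⊤ := by decide
  funext x
  rcases hgen x with rfl | rfl | rfl | rfl | rfl | rfl <;> assumption

/-- Collapse the two upper elements of the second three-element chain. -/
def collapseSnd (p : Fin 3 × Fin 3) : Fin 3 × Fin 2 :=
  (p.1, if p.2 = 0 then 0 else 1)

theorem isBddLatticeHom_collapseSnd : IsBddLatticeHom collapseSnd := by
  unfold IsBddLatticeHom
  decide

theorem surjective_collapseSnd : Function.Surjective collapseSnd := by
  unfold Function.Surjective
  decide

theorem isBddLatticeHom_swap {L K : Type*} [Lattice L] [BoundedOrder L] [Lattice K]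
    [BoundedOrder K] : IsBddLatticeHom (Prod.swap : L × K → K × L) :=
  ⟨fun _ _ => rfl, fun _ _ => rfl, rfl, rfl⟩

/-- the class of finite distributive lattices does not have the dual
Ramsey property: there are `k ≥ 2` and finite distributive lattices `A`, `B` with a
surjective `{0,1}`-homomorphism `B → A` such that for every finite distributive
lattice `C` there is a `k`-coloring of the surjective `{0,1}`-homomorphisms `C → A`,
invariant under composition with automorphisms of `A`, for which no surjective
`{0,1}`-homomorphism `w : C → B` makes `{f ∘ w : f ∈ Surj(B, A)}` monochromatic. -/
theorem no_dual_ramsey_fdl :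
    ∃ (k : ℕ), 2 ≤ k ∧ ∃ A B : FinDistLat,
      (∃ g : B.carrier → A.carrier, IsBddLatticeHom g ∧ Function.Surjective g) ∧
      ∀ C : FinDistLat, ∃ χ : (C.carrier → A.carrier) → Fin k,
        (∀ α : A.carrier → A.carrier, IsBddLatticeHom α → Function.Bijective α →
          ∀ f : C.carrier → A.carrier, IsBddLatticeHom f → Function.Surjective f →
            χ (α ∘ f) = χ f) ∧
        ∀ w : C.carrier → B.carrier, IsBddLatticeHom w → Function.Surjective w →
          ∃ f₁ f₂ : B.carrier → A.carrier,
            IsBddLatticeHom f₁ ∧ Function.Surjective f₁ ∧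
            IsBddLatticeHom f₂ ∧ Function.Surjective f₂ ∧
            χ (f₁ ∘ w) ≠ χ (f₂ ∘ w) := by
  classical
  refine ⟨2, le_rfl, ⟨Fin 3 × Fin 2⟩, ⟨Fin 3 × Fin 3⟩,
    ⟨collapseSnd, isBddLatticeHom_collapseSnd, surjective_collapseSnd⟩, fun C => ?_⟩
  let e := Fintype.equivFin C.carrier
  refine ⟨fun f => if e (birkhoffDual f ((0, 1) : Fin 3 × Fin 2)) <
    e (birkhoffDual f ((1, 0) : Fin 3 × Fin 2)) then 0 else 1, ?_, ?_⟩
  · intro α hα hb f _ _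
    rw [eq_id_of_bijective_fin_three_prod_fin_two hα hb, Function.id_comp]
  · intro w hw hs
    have hsym : IsBddLatticeHom (collapseSnd ∘ Prod.swap) :=
      isBddLatticeHom_collapseSnd.comp isBddLatticeHom_swap
    refine ⟨collapseSnd, collapseSnd ∘ Prod.swap, isBddLatticeHom_collapseSnd,
      surjective_collapseSnd, hsym, surjective_collapseSnd.comp Prod.swap_surjective, ?_⟩
    have h₁ := birkhoffDual_comp_eq isBddLatticeHom_collapseSnd hw
      (y := (0, 1)) (y' := (0, 1)) (by decide)
    have h₂ := birkhoffDual_comp_eq isBddLatticeHom_collapseSnd hw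
      (y := (1, 0)) (y' := (1, 0)) (by decide)
    have h₃ := birkhoffDual_comp_eq hsym hw (y := (0, 1)) (y' := (1, 0)) (by decide)
    have h₄ := birkhoffDual_comp_eq hsym hw (y := (1, 0)) (y' := (0, 1)) (by decide)
    have hne : e (birkhoffDual w ((0, 1) : Fin 3 × Fin 3)) ≠
        e (birkhoffDual w ((1, 0) : Fin 3 × Fin 3)) :=
      e.injective.ne ((birkhoffDual_injective hw hs).ne (by decide))
    dsimp only
    erw [h₁, h₂, h₃, h₄]
    rcases hne.lt_or_gt with h | h <;> simp [h, h.not_gt]
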